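/- (Exponential convergence under the periodic event-triggered law.) Let L be the Laplacian of a weight-balanced weighted digraph on N vertices with out-degrees dᵢ > 0, second-smallest eigenvalue λ₂ > 0 of Sym(L) = (L+Lᵀ)/2, w_max = max_i max_{j∈𝒩ᵢ} wᵢⱼ, and |𝒩_max| = max_i |𝒩ᵢ|. Let σᵢ ∈ (0,1), σ_max = max_i σᵢ, and let the sampling period h > 0 satisfy σ_max + 4 h w_max |𝒩_max| < 1. Let t_ℓ = ℓh for ℓ ∈ ℕ, let x : ℝ≥0 → ℝᴺ be continuous, and let x̂ : ℝ≥0 → ℝᴺ be constant on each interval [t_ℓ, t_{ℓ+1}) and satisfy, at each sampling time, (x̂ᵢ(t_ℓ) − xᵢ(t_ℓ))² ≤ (σᵢ/(4dᵢ)) Σⱼ wᵢⱼ(x̂ᵢ(t_ℓ) − x̂ⱼ(t_ℓ))² for all i; suppose that for all t outside a countable set, x is differentiable at t with ẋ(t) = −L x̂(t). Then there exists a constant c > 0 such that ‖x(t) − x̄‖² ≤ ‖x(0) − x̄‖² e^{−ct} for all t ≥ 0, where x̄ = (1/N)(𝟙ᴺᵀ x(0))𝟙ᴺ; in particular all agents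 exponentially converge to the average of the initial states. -/

import Mathlib

open Matrix Finset

/-- If all eigenvalues of a real symmetric matrix but one are at least `lam > 0`, then the matrix is
bounded below by `lam` on the orthogonal complement of any nonzero kernel vector. -/
lemma Matrix.IsHermitian.mul_dotProduct_le_of_kernel {ι : Type*} [Fintype ι] [DecidableEq ι]
    {A : Matrix ι ι ℝ} (hA : A.IsHermitian) (k₀ : ι) {lam : ℝ} (hlam : 0 < lam)
    (hev : ∀ k, k ≠ k₀ → lam ≤ hA.eigenvalues k) {v z : ι → ℝ} (hv : v ≠ 0)
    (hAv : A *ᵥ v = 0) (hvz : v ⬝ᵥ z = 0) : lam * (z ⬝ᵥ z) ≤ z ⬝ᵥ (A *ᵥ z) := by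
  let u : ι → ι → ℝ := fun k => (hA.eigenvectorBasis k).ofLp
  have parseval : ∀ p q : ι → ℝ, p ⬝ᵥ q = ∑ k, (u k ⬝ᵥ p) * (u k ⬝ᵥ q) := by
    intro p q
    have := hA.eigenvectorBasis.sum_inner_mul_inner (WithLp.toLp 2 p) (WithLp.toLp 2 q)
    simp only [EuclideanSpace.inner_eq_star_dotProduct, star_trivial] at this
    rw [dotProduct_comm p q, ← this]
    refine Finset.sum_congr rfl fun k _ => ?_
    rw [dotProduct_comm q]
  have coeff : ∀ p k, u k ⬝ᵥ (A *ᵥ p) = hA.eigenvalues k * (u k ⬝ᵥ p) := by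
    intro p k
    have hT : Aᵀ = A := by simpa [Matrix.IsHermitian, conjTranspose] using hA
    rw [dotProduct_mulVec, ← mulVec_transpose, hT, hA.mulVec_eigenvectorBasis k, smul_dotProduct,
      smul_eq_mul]
  have hb : ∀ k, k ≠ k₀ → u k ⬝ᵥ v = 0 := by
    intro k hk
    have := coeff v k
    rw [hAv, dotProduct_zero] at this
    exact (mul_eq_zero.mp this.symm).resolve_left (hlam.trans_le (hev k hk)).ne'
  have hb₀ : u k₀ ⬝ᵥ v ≠ 0 := by
    intro h0
    apply hv
    rw [← dotProduct_self_eq_zero, parseval v v]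
    refine Finset.sum_eq_zero fun k _ => ?_
    by_cases hk : k = k₀
    · rw [hk, h0, zero_mul]
    · rw [hb k hk, zero_mul]
  have hc₀ : u k₀ ⬝ᵥ z = 0 := by
    rw [parseval v z, Finset.sum_eq_single k₀ (fun k _ hk => by rw [hb k hk, zero_mul])
      (fun hk => absurd (Finset.mem_univ _) hk)] at hvz
    exact (mul_eq_zero.mp hvz).resolve_left hb₀
  rw [parseval z z, parseval z (A *ᵥ z), Finset.mul_sum]
  refine Finset.sum_le_sum fun k _ => ?_
  rw [coeff]
  by_cases hk : k = k₀
  · rw [hk, hc₀]; simp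
  · nlinarith [mul_le_mul_of_nonneg_right (hev k hk) (mul_self_nonneg (u k ⬝ᵥ z))]

/-- A continuous function with constant derivative off a countable set is affine. -/
lemma eq_add_mul_of_hasDerivAt_off_countable {f : ℝ → ℝ} {a b m : ℝ} {s : Set ℝ}
    (hs : s.Countable) (hab : a ≤ b) (hf : ContinuousOn f (Set.Icc a b))
    (hd : ∀ t ∈ Set.Ioo a b \ s, HasDerivAt f m t) : f b = f a + (b - a) * m := by
  have := MeasureTheory.integral_eq_of_hasDerivAt_off_countable_of_le f (fun _ => m) hab hs hf hd
    (by simp)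
  simp at this
  linarith

section Digraph

variable {ι : Type*} [Fintype ι] {W : Matrix ι ι ℝ}

lemma laplacian_mulVec_apply [DecidableEq ι] (W : Matrix ι ι ℝ) (y : ι → ℝ) (i : ι) :
    ((Matrix.diagonal (fun i => ∑ k, W i k) - W) *ᵥ y) i = ∑ j, W i j * (y i - y j) := by
  rw [sub_mulVec, Pi.sub_apply, mulVec_diagonal]
  simp [mulVec, dotProduct, mul_sub, Finset.sum_sub_distrib, Finset.sum_mul]

lemma sum_sum_mul_eq_of_balanced (hbal : ∀ i, ∑ j, W i j = ∑ j, W j i) (f : ι → ℝ) :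
    ∑ i, ∑ j, W i j * f j = ∑ i, ∑ j, W i j * f i := by
  rw [Finset.sum_comm]
  simp_rw [← Finset.sum_mul, hbal]

lemma sum_laplacian_eq_zero (hbal : ∀ i, ∑ j, W i j = ∑ j, W j i) (y : ι → ℝ) :
    ∑ i, ∑ j, W i j * (y i - y j) = 0 := by
  simp_rw [mul_sub, Finset.sum_sub_distrib, sum_sum_mul_eq_of_balanced hbal, sub_self]

lemma sum_mul_laplacian (hbal : ∀ i, ∑ j, W i j = ∑ j, W j i) (y : ι → ℝ) :
    ∑ i, y i * ∑ j, W i j * (y i - y j) = 1 / 2 * ∑ i, ∑ j, W i j * (y i - y j) ^ 2 := by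
  have hsq := sum_laplacian_eq_zero hbal (fun i => y i ^ 2)
  have : ∑ i, ∑ j, W i j * (y i - y j) ^ 2
      = 2 * ∑ i, y i * ∑ j, W i j * (y i - y j) - ∑ i, ∑ j, W i j * (y i ^ 2 - y j ^ 2) := by
    simp_rw [Finset.mul_sum, ← Finset.sum_sub_distrib]
    refine Finset.sum_congr rfl fun i _ => Finset.sum_congr rfl fun j _ => ?_
    ring
  rw [this, hsq]
  ring

lemma sq_laplacian_le (hW : ∀ i j, 0 ≤ W i j) (y : ι → ℝ) (i : ι) :
    (∑ j, W i j * (y i - y j)) ^ 2 ≤ (∑ j, W i j) * ∑ j, W i j * (y i - y j) ^ 2 :=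
  Finset.sum_sq_le_sum_mul_sum_of_sq_le_mul _ (fun j _ => hW i j)
    (fun j _ => mul_nonneg (hW i j) (sq_nonneg _)) (fun j _ => (by ring : _ = _).le)

/-- Decrease of the squared disagreement over a time `τ` at most the sampling period. -/
lemma sum_sq_step_le (hW : ∀ i j, 0 ≤ W i j) (hbal : ∀ i, ∑ j, W i j = ∑ j, W j i)
    (hd : ∀ i, 0 < ∑ j, W i j) {σ : ι → ℝ} {σm M h τ : ℝ} (hσ : ∀ i, σ i ≤ σm)
    (hM : ∀ i, ∑ j, W i j ≤ M) (hτ : 0 ≤ τ) (hτh : τ ≤ h) {x y : ι → ℝ}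
    (htrig : ∀ i, (y i - x i) ^ 2 ≤ σ i / (4 * ∑ j, W i j) * ∑ j, W i j * (y i - y j) ^ 2)
    (m : ℝ) :
    ∑ i, (x i - τ * ∑ j, W i j * (y i - y j) - m) ^ 2
      ≤ ∑ i, (x i - m) ^ 2
        - τ * ((1 - (σm + 4 * h * M)) / 2 * ∑ i, ∑ j, W i j * (y i - y j) ^ 2) := by
  have hpt : ∀ i, (x i - τ * ∑ j, W i j * (y i - y j) - m) ^ 2
      ≤ (x i - m) ^ 2 - 2 * τ * (y i * ∑ j, W i j * (y i - y j))
        + 2 * τ * m * (∑ j, W i j * (y i - y j))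
        + τ * ((1 + σm) / 2 + 2 * h * M) * ∑ j, W i j * (y i - y j) ^ 2 := by
    intro i
    have hg := sq_laplacian_le hW y i
    have ht := htrig i
    have hφ : 0 ≤ ∑ j, W i j * (y i - y j) ^ 2 :=
      Finset.sum_nonneg fun j _ => mul_nonneg (hW i j) (sq_nonneg _)
    have hdi := hd i
    have hMi := hM i
    have hσi := hσ i
    generalize ∑ j, W i j * (y i - y j) = g at *
    generalize ∑ j, W i j * (y i - y j) ^ 2 = φ at *
    generalize ∑ j, W i j = d at *
    have he : d * (y i - x i) ^ 2 ≤ σm / 4 * φ := by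
      calc d * (y i - x i) ^ 2 ≤ d * (σ i / (4 * d) * φ) := by gcongr
        _ = σ i / 4 * φ := by field_simp
        _ ≤ σm / 4 * φ := by gcongr
    have hg4 : g ^ 2 / (4 * d) ≤ φ / 4 := by
      rw [div_le_div_iff₀ (by positivity) (by norm_num)]
      nlinarith
    have hcross : (y i - x i) * g ≤ d * (y i - x i) ^ 2 + g ^ 2 / (4 * d) := by
      have : d * (y i - x i) ^ 2 + g ^ 2 / (4 * d) - (y i - x i) * g
          = d * ((y i - x i) - g / (2 * d)) ^ 2 := by field_simp; ring
      have : 0 ≤ d * ((y i - x i) - g / (2 * d)) ^ 2 := by positivity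
      linarith
    have hgM : τ * g ^ 2 ≤ 2 * h * M * φ := by
      have hM0 : 0 ≤ M := hdi.le.trans hMi
      have hh0 : 0 ≤ h := hτ.trans hτh
      calc τ * g ^ 2 ≤ h * (M * φ) := by gcongr; exact hg.trans (by gcongr)
        _ ≤ 2 * h * M * φ := by linarith [mul_nonneg hh0 (mul_nonneg hM0 hφ)]
    have htot : 2 * ((y i - x i) * g) + τ * g ^ 2 ≤ ((1 + σm) / 2 + 2 * h * M) * φ := by
      linarith
    have := mul_le_mul_of_nonneg_left htot hτ
    linarith
  refine (Finset.sum_le_sum fun i _ => hpt i).trans_eq ?_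
  rw [Finset.sum_add_distrib, Finset.sum_add_distrib, Finset.sum_sub_distrib, ← Finset.mul_sum,
    ← Finset.mul_sum, ← Finset.mul_sum, sum_mul_laplacian hbal, sum_laplacian_eq_zero hbal]
  generalize ∑ i, ∑ j, W i j * (y i - y j) ^ 2 = Φ
  generalize ∑ i, (x i - m) ^ 2 = Q
  ring

lemma sum_sq_sub_mean_le {m : ℝ} {x : ι → ℝ} (hm : ∑ i, (x i - m) = 0) (a : ℝ) :
    ∑ i, (x i - m) ^ 2 ≤ ∑ i, (x i - a) ^ 2 := by
  have : ∑ i, (x i - a) ^ 2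
      = ∑ i, (x i - m) ^ 2 + 2 * (m - a) * ∑ i, (x i - m) + ∑ _i : ι, (m - a) ^ 2 := by
    rw [Finset.mul_sum, ← Finset.sum_add_distrib, ← Finset.sum_add_distrib]
    exact Finset.sum_congr rfl fun i _ => by ring
  rw [this, hm]
  have : 0 ≤ ∑ _i : ι, (m - a) ^ 2 := Finset.sum_nonneg fun _ _ => sq_nonneg _
  linarith

/-- Under the trigger condition, the disagreement of the true states is controlled by the
Dirichlet form of the broadcast states. -/
lemma sum_sq_sub_mean_le_dirichlet (hW : ∀ i j, 0 ≤ W i j) (hd : ∀ i, 0 < ∑ j, W i j)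
    {σ : ι → ℝ} (hσ : ∀ i, σ i ≤ 1) {x y : ι → ℝ}
    (htrig : ∀ i, (y i - x i) ^ 2 ≤ σ i / (4 * ∑ j, W i j) * ∑ j, W i j * (y i - y j) ^ 2)
    {m a lam : ℝ} (hlam : 0 < lam) (hm : ∑ i, (x i - m) = 0)
    (hgap : lam * ∑ i, (y i - a) ^ 2 ≤ 1 / 2 * ∑ i, ∑ j, W i j * (y i - y j) ^ 2) :
    ∑ i, (x i - m) ^ 2
      ≤ (1 / lam + 2 * ∑ i, 1 / (4 * ∑ j, W i j)) * ∑ i, ∑ j, W i j * (y i - y j) ^ 2 := by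
  have hφ : ∀ i, 0 ≤ ∑ j, W i j * (y i - y j) ^ 2 := fun i =>
    Finset.sum_nonneg fun j _ => mul_nonneg (hW i j) (sq_nonneg _)
  have he : ∑ i, (y i - x i) ^ 2
      ≤ (∑ i, 1 / (4 * ∑ j, W i j)) * ∑ i, ∑ j, W i j * (y i - y j) ^ 2 := by
    rw [Finset.sum_mul]
    refine Finset.sum_le_sum fun i _ => (htrig i).trans ?_
    have := hd i
    exact mul_le_mul (by gcongr; exact hσ i)
      (Finset.single_le_sum (f := fun i => ∑ j, W i j * (y i - y j) ^ 2)
        (fun i _ => hφ i) (Finset.mem_univ i)) (hφ i) (by positivity)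
  have hy : ∑ i, (y i - a) ^ 2 ≤ 1 / lam * (1 / 2 * ∑ i, ∑ j, W i j * (y i - y j) ^ 2) := by
    rw [one_div_mul_eq_div, le_div_iff₀ hlam]
    linarith
  have hsplit : ∑ i, (x i - a) ^ 2 ≤ 2 * ∑ i, (y i - a) ^ 2 + 2 * ∑ i, (y i - x i) ^ 2 := by
    rw [Finset.mul_sum, Finset.mul_sum, ← Finset.sum_add_distrib]
    exact Finset.sum_le_sum fun i _ => by nlinarith [sq_nonneg (y i - a + (y i - x i))]
  have := sum_sq_sub_mean_le hm a
  linarith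

end Digraph

/-- exponential convergence under the periodic event-triggered law,
Theorem 2: for a weight-balanced digraph with Laplacian `L`, out-degrees `dᵢ > 0`,
second-smallest eigenvalue `λ₂ > 0` of `Sym(L) = (L + Lᵀ)/2`, `w_max`, `|𝒩_max|`,
`σᵢ ∈ (0,1)`, `σ_max = maxᵢ σᵢ`, and sampling period `h > 0` with
`σ_max + 4 h w_max |𝒩_max| < 1`: if `x` is continuous, `x̂` is constant on each sampling
interval `[ℓh, (ℓ+1)h)`, the trigger condition holds at each sampling time `ℓh`, and
`ẋ(t) = -L x̂(t)` for all `t` outside a countable set, then there exists `c > 0` such that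
`‖x(t) - x̄‖² ≤ ‖x(0) - x̄‖² e^{-ct}` for all `t ≥ 0`, where `x̄ = (1/N)(𝟙ᵀ x(0))𝟙`. -/
theorem periodic_event_triggered_exponential_convergence
    (N : ℕ) (hN : 1 < N) (W : Matrix (Fin N) (Fin N) ℝ)
    (hWnn : ∀ i j, 0 ≤ W i j) (hWdiag : ∀ i, W i i = 0)
    (hbal : ∀ i, ∑ j, W i j = ∑ j, W j i)
    (hd : ∀ i, 0 < ∑ j, W i j)
    (hne : ∀ i, (Finset.univ.filter (fun j => 0 < W i j)).Nonempty)
    (L : Matrix (Fin N) (Fin N) ℝ)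
    (hL : L = Matrix.diagonal (fun i => ∑ k, W i k) - W)
    (S : Matrix (Fin N) (Fin N) ℝ) (hS : S = (1/2 : ℝ) • (L + Lᵀ))
    (hherm : S.IsHermitian)
    (μ : Fin N → ℝ) (hmono : Monotone μ) (π : Equiv.Perm (Fin N))
    (hμ : ∀ k, μ k = hherm.eigenvalues (π k))
    (hlam2 : 0 < μ ⟨1, hN⟩)
    (σ : Fin N → ℝ) (hσ : ∀ i, σ i ∈ Set.Ioo (0 : ℝ) 1)
    (wmax Nmax σmax : ℝ)
    (hwmax : wmax = Finset.univ.sup' ⟨⟨0, by omega⟩, Finset.mem_univ _⟩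
      (fun i => (Finset.univ.filter (fun j => 0 < W i j)).sup' (hne i) (fun j => W i j)))
    (hNmax : Nmax = Finset.univ.sup' ⟨⟨0, by omega⟩, Finset.mem_univ _⟩
      (fun i => ((Finset.univ.filter (fun j => 0 < W i j)).card : ℝ)))
    (hσmax : σmax = Finset.univ.sup' ⟨⟨0, by omega⟩, Finset.mem_univ _⟩ σ)
    (h : ℝ) (hh : 0 < h)
    (hbound : σmax + 4 * h * wmax * Nmax < 1)
    (x xhat : ℝ → Fin N → ℝ)
    (hcont : ∀ i, ContinuousOn (fun t => x t i) (Set.Ici (0 : ℝ)))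
    (hpiecewise : ∀ ℓ : ℕ, ∀ t ∈ Set.Ico ((ℓ : ℝ) * h) (((ℓ : ℝ) + 1) * h),
      xhat t = xhat ((ℓ : ℝ) * h))
    (htrig : ∀ ℓ : ℕ, ∀ i, (xhat ((ℓ : ℝ) * h) i - x ((ℓ : ℝ) * h) i)^2 ≤
      σ i / (4 * ∑ j, W i j) *
        ∑ j, W i j * (xhat ((ℓ : ℝ) * h) i - xhat ((ℓ : ℝ) * h) j)^2)
    (s : Set ℝ) (hs : s.Countable)
    (hderiv : ∀ t ∈ Set.Ici (0 : ℝ), t ∉ s →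
      ∀ i, HasDerivAt (fun u => x u i) (-(L.mulVec (xhat t)) i) t) :
    ∃ c > (0 : ℝ), ∀ t ∈ Set.Ici (0 : ℝ),
      ∑ i, (x t i - (1 / (N : ℝ)) * ∑ j, x 0 j)^2
        ≤ (∑ i, (x 0 i - (1 / (N : ℝ)) * ∑ j, x 0 j)^2) * Real.exp (-(c * t)) := by
  have hNpos : (0 : ℝ) < N := by exact_mod_cast (by omega : 0 < N)
  have hg : ∀ y i, (L *ᵥ y) i = ∑ j, W i j * (y i - y j) := fun y i => by
    rw [hL, laplacian_mulVec_apply]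
  -- spectral gap
  have hgap : ∀ y : Fin N → ℝ, μ ⟨1, hN⟩ * ∑ i, (y i - (1 / (N : ℝ)) * ∑ j, y j) ^ 2
      ≤ 1 / 2 * ∑ i, ∑ j, W i j * (y i - y j) ^ 2 := by
    intro y
    have hev : ∀ k, k ≠ π ⟨0, by omega⟩ → μ ⟨1, hN⟩ ≤ hherm.eigenvalues k := by
      intro k hk
      obtain ⟨l, rfl⟩ := π.surjective k
      rw [← hμ]
      apply hmono
      rw [Fin.le_def]
      have : l ≠ ⟨0, by omega⟩ := fun h0 => hk (by rw [h0])
      rw [Ne, Fin.ext_iff] at this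
      simp only at this ⊢
      omega
    have hS1 : S *ᵥ (fun _ => 1) = 0 := by
      have h1 : L *ᵥ (fun _ => 1) = 0 := by
        ext i
        simp [hg]
      have h2 : Lᵀ *ᵥ (fun _ => 1) = 0 := by
        ext i
        simp [hL, mulVec, dotProduct, diagonal_apply, hbal i]
      rw [hS, smul_mulVec, add_mulVec, h1, h2, add_zero, smul_zero]
    have hquad : ∀ z, z ⬝ᵥ (S *ᵥ z) = z ⬝ᵥ (L *ᵥ z) := by
      intro z
      have : z ⬝ᵥ (Lᵀ *ᵥ z) = z ⬝ᵥ (L *ᵥ z) := by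
        rw [mulVec_transpose, dotProduct_comm, ← dotProduct_mulVec]
      rw [hS, smul_mulVec, add_mulVec, dotProduct_smul, dotProduct_add, this, smul_eq_mul]
      ring
    have key := hherm.mul_dotProduct_le_of_kernel (π ⟨0, by omega⟩) hlam2 hev
      (v := fun _ => 1) (z := fun i => y i - (1 / (N : ℝ)) * ∑ j, y j)
      (fun h0 => one_ne_zero (congrFun h0 ⟨0, by omega⟩)) hS1
      (by simp [dotProduct, Finset.sum_sub_distrib]; field_simp; ring)
    rw [hquad] at key
    simp only [dotProduct, hg, sum_mul_laplacian hbal] at key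
    simpa [pow_two] using key
  have hMd : ∀ i, ∑ j, W i j ≤ wmax * Nmax := by
    intro i
    have hw : ∀ j ∈ Finset.univ.filter (fun j => 0 < W i j), W i j ≤ wmax := by
      intro j hj
      rw [hwmax]
      exact (Finset.le_sup' (fun j => W i j) hj).trans (Finset.le_sup'
        (fun i => (Finset.univ.filter (fun j => 0 < W i j)).sup' (hne i) (fun j => W i j))
        (Finset.mem_univ i))
    have hw0 : 0 ≤ wmax := by
      obtain ⟨j, hj⟩ := hne i
      exact (hWnn i j).trans (hw j hj)
    have hc : ((Finset.univ.filter (fun j => 0 < W i j)).card : ℝ) ≤ Nmax := by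
      rw [hNmax]
      exact Finset.le_sup' (fun i => ((Finset.univ.filter (fun j => 0 < W i j)).card : ℝ))
        (Finset.mem_univ i)
    calc ∑ j, W i j = ∑ j ∈ Finset.univ.filter (fun j => 0 < W i j), W i j := by
          symm
          apply Finset.sum_filter_of_ne
          intro j _ hj
          exact (hWnn i j).lt_of_ne' hj
      _ ≤ (Finset.univ.filter (fun j => 0 < W i j)).card • wmax := Finset.sum_le_card_nsmul _ _ _ hw
      _ = wmax * ((Finset.univ.filter (fun j => 0 < W i j)).card : ℝ) := by
          rw [nsmul_eq_mul, mul_comm]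
      _ ≤ wmax * Nmax := by gcongr
  have hσm : ∀ i, σ i ≤ σmax := fun i => by
    rw [hσmax]
    exact Finset.le_sup' σ (Finset.mem_univ i)
  have hflow : ∀ ℓ : ℕ, ∀ t ∈ Set.Icc ((ℓ : ℝ) * h) (((ℓ : ℝ) + 1) * h), ∀ i,
      x t i = x (ℓ * h) i - (t - ℓ * h)
        * ∑ j, W i j * (xhat (ℓ * h) i - xhat (ℓ * h) j) := by
    intro ℓ t ht i
    have hℓ : 0 ≤ (ℓ : ℝ) * h := by positivity
    have := eq_add_mul_of_hasDerivAt_off_countable (f := fun u => x u i)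
      (m := -(L *ᵥ xhat (ℓ * h)) i) hs ht.1
      ((hcont i).mono fun u hu => hℓ.trans hu.1) (fun u hu => by
        rw [← hpiecewise ℓ u ⟨hu.1.1.le, hu.1.2.trans_le ht.2⟩]
        exact hderiv u (hℓ.trans hu.1.1.le) hu.2 i)
    rw [hg] at this
    linarith
  set m : ℝ := (1 / (N : ℝ)) * ∑ j, x 0 j with hm
  set κ : ℝ := (1 - (σmax + 4 * h * (wmax * Nmax))) / 2 with hκ
  set K : ℝ := 1 / μ ⟨1, hN⟩ + 2 * ∑ i, 1 / (4 * ∑ j, W i j) with hK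
  have hκpos : 0 < κ := by
    rw [hκ]
    linarith
  have hKpos : 0 < K := by
    have : 0 ≤ ∑ i, 1 / (4 * ∑ j, W i j) := Finset.sum_nonneg fun i _ => by
      have := hd i
      positivity
    positivity
  have hstep : ∀ ℓ : ℕ, ∑ i, (x (ℓ * h) i - m) = 0 →
      ∀ t ∈ Set.Icc ((ℓ : ℝ) * h) (((ℓ : ℝ) + 1) * h),
        ∑ i, (x t i - m) = 0 ∧ ∑ i, (x t i - m) ^ 2
          ≤ (∑ i, (x (ℓ * h) i - m) ^ 2) * Real.exp (-(κ / K * (t - ℓ * h))) := by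
    intro ℓ hmean t ht
    have hτ : 0 ≤ t - ℓ * h := sub_nonneg.mpr ht.1
    have hτh : t - ℓ * h ≤ h := by linarith [ht.2]
    simp_rw [hflow ℓ t ht]
    constructor
    · have h0 := sum_laplacian_eq_zero hbal (xhat (ℓ * h))
      simp_rw [sub_right_comm _ _ m]
      rw [Finset.sum_sub_distrib, hmean, ← Finset.mul_sum, h0, mul_zero, sub_zero]
    · have hdec := sum_sq_step_le hWnn hbal hd hσm hMd hτ hτh (htrig ℓ) m
      have hdir := sum_sq_sub_mean_le_dirichlet hWnn hd (fun i => (hσ i).2.le) (htrig ℓ) hlam2 hmean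
        (hgap (xhat (ℓ * h)))
      rw [← hκ] at hdec
      rw [← hK] at hdir
      set Q := ∑ i, (x (ℓ * h) i - m) ^ 2
      set Φ := ∑ i, ∑ j, W i j * (xhat (ℓ * h) i - xhat (ℓ * h) j) ^ 2
      have hQ : 0 ≤ Q := Finset.sum_nonneg fun _ _ => sq_nonneg _
      have hrate : κ / K * Q ≤ κ * Φ := by
        rw [div_mul_eq_mul_div, div_le_iff₀ hKpos]
        nlinarith
      calc _ ≤ Q - (t - ℓ * h) * (κ * Φ) := hdec
        _ ≤ Q - (t - ℓ * h) * (κ / K * Q) := by gcongr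
        _ = Q * (-(κ / K * (t - ℓ * h)) + 1) := by ring
        _ ≤ Q * Real.exp (-(κ / K * (t - ℓ * h))) := by
          gcongr
          exact Real.add_one_le_exp _
  have hsample : ∀ ℓ : ℕ, ∑ i, (x (ℓ * h) i - m) = 0 ∧
      ∑ i, (x (ℓ * h) i - m) ^ 2
        ≤ (∑ i, (x 0 i - m) ^ 2) * Real.exp (-(κ / K * (ℓ * h))) := by
    intro ℓ
    induction ℓ with
    | zero =>
      simp only [Nat.cast_zero, zero_mul, mul_zero, neg_zero, Real.exp_zero, mul_one, le_refl,
        and_true]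
      simp [hm, Finset.sum_sub_distrib]
      field_simp
      ring
    | succ ℓ ih =>
      obtain ⟨h1, h2⟩ := hstep ℓ ih.1 (((ℓ : ℝ) + 1) * h) ⟨by linarith, le_refl _⟩
      push_cast
      refine ⟨h1, h2.trans ?_⟩
      calc _ ≤ _ := mul_le_mul_of_nonneg_right ih.2 (Real.exp_pos _).le
        _ = _ := by
          rw [mul_assoc, ← Real.exp_add]
          congr 2
          ring
  refine ⟨κ / K, div_pos hκpos hKpos, fun t ht => ?_⟩
  have ht0 : 0 ≤ t := ht
  have hfl : (⌊t / h⌋₊ : ℝ) * h ≤ t := by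
    rw [← le_div_iff₀ hh]
    exact Nat.floor_le (by positivity)
  have hfu : t ≤ ((⌊t / h⌋₊ : ℝ) + 1) * h := by
    rw [← div_le_iff₀ hh]
    exact (Nat.lt_floor_add_one _).le
  have hs' := hsample ⌊t / h⌋₊
  refine (hstep _ hs'.1 t ⟨hfl, hfu⟩).2.trans ?_
  calc _ ≤ _ := mul_le_mul_of_nonneg_right hs'.2 (Real.exp_pos _).le
    _ = _ := by
      rw [mul_assoc, ← Real.exp_add]
      congr 2
      ring
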